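/- Let Φw_L be a Lyapunov function with rate β ∈ [0,1) for a finite MDP. Let w* ∈ W minimize ‖V* − Φw‖_{∞,1/Φw_L} over W, set w̄ = w* + ‖V* − Φw*‖_{∞,1/Φw_L} · (2/(1−β) − 1) · w_L, and assume w̄ ∈ W. Let ρ be a probability distribution on S and let w̃ be a RALP solution (all state-action constraints present). Then ‖V* − Φw̃‖_{1,ρ} ≤ (2 ∑_s ρ(s)(Φw_L)(s) / (1−β)) · min_{w∈W} ‖V* − Φw‖_{∞,1/Φw_L}. -/

import Mathlib

open Finset

section Defs

variable {S A : Type*} [Fintype S] [Nonempty S] [Fintype A] [Nonempty A]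

/-- The Bellman operator: `(T V)(s) = max_a [R(s) + γ ∑_{s'} P(s'|s,a) V(s')]`. -/
noncomputable def bellman (P : S → A → S → ℝ) (R : S → ℝ) (γ : ℝ) (V : S → ℝ) (s : S) : ℝ :=
  univ.sup' univ_nonempty fun a => R s + γ * ∑ s', P s a s' * V s'

/-- The operator `H`: `(H L)(s) = max_a ∑_{s'} P(s'|s,a) L(s')`. -/
noncomputable def Hop (P : S → A → S → ℝ) (L : S → ℝ) (s : S) : ℝ :=
  univ.sup' univ_nonempty fun a => ∑ s', P s a s' * L s'

/-- `(Φ w)(s) = ∑ i, Φ_i(s) w_i`. -/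
def phiW {k : ℕ} (Φ : S → Fin (k + 1) → ℝ) (w : Fin (k + 1) → ℝ) (s : S) : ℝ :=
  ∑ i, Φ s i * w i

/-- `‖w‖_{-1}`: the ℓ¹ norm of `w` with the bias coordinate (index 0) excluded. -/
def normNeg1 {k : ℕ} (w : Fin (k + 1) → ℝ) : ℝ :=
  ∑ i ∈ Finset.univ.erase 0, |w i|

/-- The weighted max-norm `‖U‖_{∞,1/L} = max_s |U(s)| / L(s)`. -/
noncomputable def wmaxNorm (L U : S → ℝ) : ℝ :=
  univ.sup' univ_nonempty fun s => |U s| / L s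

/-- The weighted L¹ norm `‖U‖_{1,ρ} = ∑_s ρ(s) |U(s)|`. -/
def w1Norm (ρ U : S → ℝ) : ℝ := ∑ s, ρ s * |U s|

/-- The max-absolute-value norm on functions `S → ℝ`. -/
noncomputable def maxNorm (U : S → ℝ) : ℝ :=
  univ.sup' univ_nonempty fun s => |U s|

/-- RALP feasibility: `‖w‖_{-1} ≤ ψ` and all Bellman (state-action) constraints hold. -/
def RALPfeasible {k : ℕ} (P : S → A → S → ℝ) (R : S → ℝ) (γ : ℝ)
    (Φ : S → Fin (k + 1) → ℝ) (ψ : ℝ) (w : Fin (k + 1) → ℝ) : Prop :=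
  normNeg1 w ≤ ψ ∧
    ∀ s a, R s + γ * ∑ s', P s a s' * phiW Φ w s' ≤ phiW Φ w s

/-- A RALP solution: a feasible `w` minimizing `∑ s, ρ s * (Φ w)(s)` over feasible vectors. -/
def RALPsolution {k : ℕ} (P : S → A → S → ℝ) (R : S → ℝ) (γ : ℝ)
    (Φ : S → Fin (k + 1) → ℝ) (ψ : ℝ) (ρ : S → ℝ) (w : Fin (k + 1) → ℝ) : Prop :=
  RALPfeasible P R γ Φ ψ w ∧
    ∀ w', RALPfeasible P R γ Φ ψ w' →
      ∑ s, ρ s * phiW Φ w s ≤ ∑ s, ρ s * phiW Φ w' s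

end Defs

/-- Each one-step lookahead value is at most the Bellman update. -/
lemma lookahead_le_bellman {S A : Type*} [Fintype S] [Fintype A] [Nonempty A]
    (P : S → A → S → ℝ) (R : S → ℝ) (γ : ℝ) (V : S → ℝ) (s : S) (a : A) :
    R s + γ * ∑ s', P s a s' * V s' ≤ bellman P R γ V s :=
  le_sup' (fun a => R s + γ * ∑ s', P s a s' * V s') (mem_univ a)

/-- A function satisfying all the Bellman inequalities dominates every fixed point of the
Bellman operator. -/
lemma le_of_bellman_fixedPoint_of_lookahead_le {S A : Type*} [Fintype S] [Nonempty S]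
    [Fintype A] [Nonempty A] {P : S → A → S → ℝ} {R : S → ℝ} {γ : ℝ}
    (hγ0 : 0 ≤ γ) (hγ1 : γ < 1)
    (hP0 : ∀ s a s', 0 ≤ P s a s') (hP1 : ∀ s a, ∑ s', P s a s' = 1)
    {U V : S → ℝ} (hU : ∀ s, bellman P R γ U s = U s)
    (hV : ∀ s a, R s + γ * ∑ s', P s a s' * V s' ≤ V s) (s : S) : U s ≤ V s := by
  obtain ⟨t, ht⟩ := Finite.exists_max fun s => U s - V s
  obtain ⟨a, -, ha⟩ := exists_mem_eq_sup' (univ_nonempty (α := A))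
    fun a => R t + γ * ∑ s', P t a s' * U s'
  have hUt : U t = R t + γ * ∑ s', P t a s' * U s' := (hU t).symm.trans ha
  have hsum : ∑ s', P t a s' * U s' ≤ ∑ s', P t a s' * V s' + (U t - V t) := by
    calc ∑ s', P t a s' * U s' ≤ ∑ s', P t a s' * (V s' + (U t - V t)) :=
          sum_le_sum fun s' _ => mul_le_mul_of_nonneg_left (by linarith [ht s']) (hP0 t a s')
      _ = _ := by simp_rw [mul_add, sum_add_distrib, ← sum_mul, hP1, one_mul]
  have hγsum := mul_le_mul_of_nonneg_left hsum hγ0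
  have hmax : U t - V t ≤ 0 := by
    by_contra! hpos
    nlinarith [hV t a]
  linarith [ht s]

/-- A Lyapunov function contracts under every action, up to the factor `γ`. -/
lemma mul_sum_le_of_mul_Hop_le {S A : Type*} [Fintype S] [Fintype A] [Nonempty A]
    {P : S → A → S → ℝ} {γ β : ℝ} (hγ0 : 0 ≤ γ) {L : S → ℝ}
    (hL : ∀ s, γ * Hop P L s ≤ β * L s) (s : S) (a : A) :
    γ * ∑ s', P s a s' * L s' ≤ β * L s :=
  (mul_le_mul_of_nonneg_left
    (le_sup' (fun a => ∑ s', P s a s' * L s') (mem_univ a)) hγ0).trans (hL s)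

/-- Shifting an approximation of a Bellman fixed point by a suitable multiple of a Lyapunov
function makes it satisfy all the Bellman inequalities. -/
lemma lookahead_le_add_mul_lyapunov {S A : Type*} [Fintype S] [Fintype A] [Nonempty A]
    {P : S → A → S → ℝ} {R : S → ℝ} {γ β ε c : ℝ} (hγ0 : 0 ≤ γ)
    (hP0 : ∀ s a s', 0 ≤ P s a s') {U V L : S → ℝ} (hU : ∀ s, bellman P R γ U s = U s)
    (hL : ∀ s, γ * Hop P L s ≤ β * L s) (hUV : ∀ s, |U s - V s| ≤ ε * L s)
    (hε : 0 ≤ ε) (hc0 : 0 ≤ c) (hc : 1 + β + β * c = c) (s : S) (a : A) :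
    R s + γ * ∑ s', P s a s' * (V s' + ε * c * L s') ≤ V s + ε * c * L s := by
  have hsum : ∑ s', P s a s' * (V s' + ε * c * L s') ≤
      ∑ s', P s a s' * U s' + ε * (1 + c) * ∑ s', P s a s' * L s' := by
    rw [mul_sum, ← sum_add_distrib]
    refine sum_le_sum fun s' _ => ?_
    have := mul_le_mul_of_nonneg_left (neg_le_of_abs_le (hUV s')) (hP0 s a s')
    linarith
  have hγsum := mul_le_mul_of_nonneg_left hsum hγ0
  have hlyap := mul_le_mul_of_nonneg_left (mul_sum_le_of_mul_Hop_le hγ0 hL s a)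
    (by positivity : 0 ≤ ε * (1 + c))
  have hfix := (lookahead_le_bellman P R γ U s a).trans_eq (hU s)
  have hcL : ε * L s * (1 + β + β * c) = ε * L s * c := by rw [hc]
  linarith [le_of_abs_le (hUV s)]

/-- The weighted max-norm bounds the function pointwise. -/
lemma abs_le_wmaxNorm_mul {S : Type*} [Fintype S] [Nonempty S] {L : S → ℝ}
    (hL : ∀ s, 0 < L s) (U : S → ℝ) (s : S) : |U s| ≤ wmaxNorm L U * L s :=
  (div_le_iff₀ (hL s)).1 (le_sup' (fun s => |U s| / L s) (mem_univ s))

lemma wmaxNorm_nonneg {S : Type*} [Fintype S] [Nonempty S] {L : S → ℝ}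
    (hL : ∀ s, 0 < L s) (U : S → ℝ) : 0 ≤ wmaxNorm L U :=
  let s := Classical.arbitrary S
  (div_nonneg (abs_nonneg (U s)) (hL s).le).trans
    (le_sup' (fun s => |U s| / L s) (mem_univ s))

lemma phiW_add_mul {S : Type*} {k : ℕ} (Φ : S → Fin (k + 1) → ℝ) (w v : Fin (k + 1) → ℝ)
    (c : ℝ) (s : S) : phiW Φ (fun i => w i + c * v i) s = phiW Φ w s + c * phiW Φ v s := by
  simp only [phiW, mul_sum, ← sum_add_distrib]
  exact sum_congr rfl fun i _ => by ring

/-- the RALP error bound (Lemma 1, all state-action constraints present). -/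
theorem statement_1 {S A : Type*} [Fintype S] [Nonempty S] [Fintype A] [Nonempty A]
    (P : S → A → S → ℝ) (R : S → ℝ) (γ : ℝ)
    (hγ0 : 0 ≤ γ) (hγ1 : γ < 1)
    (hP0 : ∀ s a s', 0 ≤ P s a s') (hP1 : ∀ s a, ∑ s', P s a s' = 1)
    (Vstar : S → ℝ) (hVstar : ∀ s, bellman P R γ Vstar s = Vstar s)
    {k : ℕ} (Φ : S → Fin (k + 1) → ℝ) (hbias : ∀ s, Φ s 0 = 1)
    (ψ : ℝ) (hψ : 0 < ψ)
    (wL : Fin (k + 1) → ℝ) (β : ℝ) (hβ0 : 0 ≤ β) (hβ1 : β < 1)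
    (hLpos : ∀ s, 0 < phiW Φ wL s)
    (hLyap : ∀ s, γ * Hop P (phiW Φ wL) s ≤ β * phiW Φ wL s)
    (ρ : S → ℝ) (hρ0 : ∀ s, 0 ≤ ρ s) (hρ1 : ∑ s, ρ s = 1)
    (wstar : Fin (k + 1) → ℝ) (hwstarW : normNeg1 wstar ≤ ψ)
    (hwstarMin : ∀ w : Fin (k + 1) → ℝ, normNeg1 w ≤ ψ →
      wmaxNorm (phiW Φ wL) (fun s => Vstar s - phiW Φ wstar s) ≤
        wmaxNorm (phiW Φ wL) (fun s => Vstar s - phiW Φ w s))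
    (wbar : Fin (k + 1) → ℝ)
    (hwbar : wbar = fun i => wstar i +
      wmaxNorm (phiW Φ wL) (fun s => Vstar s - phiW Φ wstar s) * (2 / (1 - β) - 1) * wL i)
    (hwbarW : normNeg1 wbar ≤ ψ)
    (wtilde : Fin (k + 1) → ℝ)
    (hwtilde : RALPsolution P R γ Φ ψ ρ wtilde) :
    w1Norm ρ (fun s => Vstar s - phiW Φ wtilde s) ≤
      2 * (∑ s, ρ s * phiW Φ wL s) / (1 - β) *
        wmaxNorm (phiW Φ wL) (fun s => Vstar s - phiW Φ wstar s) := by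
  obtain ⟨⟨-, hfeas⟩, hopt⟩ := hwtilde
  have hβ : 0 < 1 - β := sub_pos.2 hβ1
  have hε := wmaxNorm_nonneg hLpos fun s => Vstar s - phiW Φ wstar s
  have happrox := abs_le_wmaxNorm_mul hLpos fun s => Vstar s - phiW Φ wstar s
  set ε := wmaxNorm (phiW Φ wL) fun s => Vstar s - phiW Φ wstar s
  have hc0 : 0 ≤ 2 / (1 - β) - 1 := by
    rw [sub_nonneg, le_div_iff₀ hβ]
    linarith
  have hphi : ∀ s, phiW Φ wbar s =
      phiW Φ wstar s + ε * (2 / (1 - β) - 1) * phiW Φ wL s := fun s => by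
    rw [hwbar, phiW_add_mul]
  have hbarFeas : RALPfeasible P R γ Φ ψ wbar := by
    refine ⟨hwbarW, fun s a => ?_⟩
    simp only [hphi]
    exact lookahead_le_add_mul_lyapunov hγ0 hP0 hVstar hLyap happrox hε hc0
      (by field_simp; ring) s a
  have hdom := le_of_bellman_fixedPoint_of_lookahead_le hγ0 hγ1 hP0 hP1 hVstar hfeas
  calc w1Norm ρ (fun s => Vstar s - phiW Φ wtilde s)
      = ∑ s, ρ s * phiW Φ wtilde s - ∑ s, ρ s * Vstar s := by
        rw [w1Norm, ← sum_sub_distrib]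
        refine sum_congr rfl fun s _ => ?_
        rw [abs_of_nonpos (sub_nonpos.2 (hdom s))]
        ring
    _ ≤ ∑ s, ρ s * phiW Φ wbar s - ∑ s, ρ s * Vstar s :=
        sub_le_sub_right (hopt wbar hbarFeas) _
    _ ≤ ∑ s, ρ s * phiW Φ wL s * (2 / (1 - β) * ε) := by
        rw [← sum_sub_distrib]
        refine sum_le_sum fun s _ => ?_
        have := mul_le_mul_of_nonneg_left (neg_le_of_abs_le (happrox s)) (hρ0 s)
        rw [hphi]
        linarith
    _ = 2 * (∑ s, ρ s * phiW Φ wL s) / (1 - β) * ε := by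
        rw [← sum_mul]
        ring
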